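/- Let T be a near-triangulation with boundary cycle C = (u_1, ..., u_h, u_1) and let e_i = (u_i, u_{i+1}) be a boundary edge of T (indices modulo h). If the graph T − e_i, obtained by deleting the edge e_i, is isomorphic to H_1 or H_2, then T has a total dominating set of size 4 containing u_i or u_{i+1}. -/

import Mathlib

/-!
Common definitions.

A *plane graph* is a finite graph whose vertices are points of the plane `ℝ × ℝ` and whose
edges are drawn as straight-line segments between their endpoints (by Fáry's theorem every
planar graph admits such a drawing).  A *near-triangulation* is a plane graph that is properly
embedded, biconnected, and all of whose bounded faces are triangles (the faces are the
connected components of the complement of the drawing).  The boundary cycle lists, cyclically,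
the vertices on the outer (unbounded) face.
-/

open scoped Classical

noncomputable section

/-- A finite graph drawn in the plane: the vertices are points of `ℝ × ℝ` and each edge is
drawn as the straight-line segment between its endpoints. -/
structure PlaneGraph where
  verts : Finset (ℝ × ℝ)
  Adj : ℝ × ℝ → ℝ × ℝ → Prop
  symm : ∀ p q, Adj p q → Adj q p
  loopless : ∀ p, ¬ Adj p p
  mem_of_adj : ∀ p q, Adj p q → p ∈ verts ∧ q ∈ verts

namespace PlaneGraph

variable (G : PlaneGraph)

/-- The union of the (closed) segments realizing the edges of the graph. -/
def drawing : Set (ℝ × ℝ) := {x | ∃ p q, G.Adj p q ∧ x ∈ segment ℝ p q}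

/-- The straight-line drawing is a proper plane embedding: two edges meet only in common
endpoints and no vertex lies on an edge of which it is not an endpoint. -/
def IsEmbedded : Prop :=
  (∀ p q r s, G.Adj p q → G.Adj r s → ∀ x, x ∈ segment ℝ p q → x ∈ segment ℝ r s →
      ({p, q} : Set (ℝ × ℝ)) = {r, s} ∨
        (x ∈ ({p, q} : Set (ℝ × ℝ)) ∧ x ∈ ({r, s} : Set (ℝ × ℝ)))) ∧
  (∀ p q v, G.Adj p q → v ∈ G.verts → v ∈ segment ℝ p q → v = p ∨ v = q)

/-- Reachability by walks in the graph. -/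
def Reachable (p q : ℝ × ℝ) : Prop := Relation.ReflTransGen G.Adj p q

/-- The graph is connected. -/
def Connected : Prop := G.verts.Nonempty ∧ ∀ p ∈ G.verts, ∀ q ∈ G.verts, G.Reachable p q

/-- Deletion of a set of vertices together with all incident edges. -/
def deleteVerts (S : Finset (ℝ × ℝ)) : PlaneGraph where
  verts := G.verts \ S
  Adj := fun p q => G.Adj p q ∧ p ∉ S ∧ q ∉ S
  symm := fun p q h => ⟨G.symm p q h.1, h.2.2, h.2.1⟩
  loopless := fun p h => G.loopless p h.1
  mem_of_adj := fun p q h => by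
    obtain ⟨h1, h2⟩ := G.mem_of_adj p q h.1
    exact ⟨Finset.mem_sdiff.mpr ⟨h1, h.2.1⟩, Finset.mem_sdiff.mpr ⟨h2, h.2.2⟩⟩

/-- Deletion of a single edge (keeping all vertices). -/
def deleteEdge (p q : ℝ × ℝ) : PlaneGraph where
  verts := G.verts
  Adj := fun a b => G.Adj a b ∧ ¬ ((a = p ∧ b = q) ∨ (a = q ∧ b = p))
  symm := fun a b h => ⟨G.symm a b h.1, by tauto⟩
  loopless := fun a h => G.loopless a h.1
  mem_of_adj := fun a b h => G.mem_of_adj a b h.1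

/-- The (abstract, simple) graph obtained by contracting the edge `(p, q)`:
the vertex `q` is merged into `p`, which becomes the new contracted vertex. -/
def contractEdge (p q : ℝ × ℝ) : PlaneGraph where
  verts := G.verts.erase q
  Adj := fun a b =>
    a ≠ b ∧ a ∈ G.verts.erase q ∧ b ∈ G.verts.erase q ∧
      (G.Adj a b ∨ (a = p ∧ G.Adj q b) ∨ (b = p ∧ G.Adj q a))
  symm := fun a b h => by
    obtain ⟨h1, h2, h3, h4⟩ := h
    refine ⟨h1.symm, h3, h2, ?_⟩
    rcases h4 with h4 | h4 | h4
    · exact Or.inl (G.symm _ _ h4)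
    · exact Or.inr (Or.inr h4)
    · exact Or.inr (Or.inl h4)
  loopless := fun a h => h.1 rfl
  mem_of_adj := fun a b h => ⟨h.2.1, h.2.2.1⟩

/-- Biconnectivity: at least three vertices, connected, and deleting any single vertex leaves
a connected graph. -/
def Biconnected : Prop :=
  3 ≤ G.verts.card ∧ G.Connected ∧ ∀ v ∈ G.verts, (G.deleteVerts {v}).Connected

/-- A face of the plane graph: a connected component of the complement of the drawing. -/
def IsFace (F : Set (ℝ × ℝ)) : Prop :=
  ∃ x, x ∉ G.drawing ∧ F = connectedComponentIn G.drawingᶜ x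

/-- The open triangle with the three given corners. -/
def openTriangle (a b c : ℝ × ℝ) : Set (ℝ × ℝ) :=
  interior (convexHull ℝ ({a, b, c} : Set (ℝ × ℝ)))

/-- Every bounded (inner) face of the drawing is a triangular face of the graph. -/
def InnerFacesTriangles : Prop :=
  ∀ F, G.IsFace F → Bornology.IsBounded F →
    ∃ a ∈ G.verts, ∃ b ∈ G.verts, ∃ c ∈ G.verts,
      G.Adj a b ∧ G.Adj b c ∧ G.Adj a c ∧ F = openTriangle a b c

/-- A near-triangulation: a properly embedded biconnected plane graph all of whose faces are
triangles, except possibly the outer (unbounded) face. -/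
def IsNearTriangulation : Prop :=
  G.IsEmbedded ∧ G.Biconnected ∧ G.InnerFacesTriangles

/-- The outer region: the union of the unbounded components of the complement of the
drawing (for a near-triangulation this is the outer face). -/
def outerRegion : Set (ℝ × ℝ) :=
  {x | x ∉ G.drawing ∧ ¬ Bornology.IsBounded (connectedComponentIn G.drawingᶜ x)}

/-- `u : ZMod h → ℝ × ℝ` is the boundary cycle of `G`: an injective cyclic sequence
`u 0, u 1, …, u (h-1)` of vertices, consecutive ones adjacent, whose edges bound the outer
face and which contains every vertex lying on the boundary of the outer face. -/
def IsBoundaryCycle {h : ℕ} (u : ZMod h → ℝ × ℝ) : Prop :=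
  3 ≤ h ∧ Function.Injective u ∧
  (∀ i, u i ∈ G.verts) ∧
  (∀ i, G.Adj (u i) (u (i + 1))) ∧
  (∀ i, segment ℝ (u i) (u (i + 1)) ⊆ frontier G.outerRegion) ∧
  (∀ v ∈ G.verts, (v : ℝ × ℝ) ∈ frontier G.outerRegion → v ∈ Set.range u)

/-- An interior vertex: a vertex not on the boundary cycle. -/
def IsInteriorVtx {h : ℕ} (u : ZMod h → ℝ × ℝ) (v : ℝ × ℝ) : Prop :=
  v ∈ G.verts ∧ v ∉ Set.range u

/-- The edge `(p, q)` is a diagonal: it joins two non-consecutive boundary vertices. -/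
def IsDiagonalEdge {h : ℕ} (u : ZMod h → ℝ × ℝ) (p q : ℝ × ℝ) : Prop :=
  G.Adj p q ∧ ∃ i j : ZMod h, p = u i ∧ q = u j ∧ j ≠ i + 1 ∧ i ≠ j + 1

/-- The graph has no diagonals: any edge between boundary vertices joins consecutive ones. -/
def HasNoDiagonals {h : ℕ} (u : ZMod h → ℝ × ℝ) : Prop :=
  ∀ i j : ZMod h, G.Adj (u i) (u j) → j = i + 1 ∨ i = j + 1

/-- The degree of a vertex. -/
def degree (v : ℝ × ℝ) : ℕ := (G.verts.filter (fun w => G.Adj v w)).card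

/-- The degree of a vertex in the subgraph induced on the set `S` of vertices. -/
def degreeOn (S : Set (ℝ × ℝ)) (v : ℝ × ℝ) : ℕ :=
  (G.verts.filter (fun w => G.Adj v w ∧ w ∈ S)).card

/-- A total dominating set: every vertex of the graph is adjacent to a member of `D`. -/
def IsTDS (D : Finset (ℝ × ℝ)) : Prop :=
  D ⊆ G.verts ∧ ∀ v ∈ G.verts, ∃ d ∈ D, G.Adj v d

/-- The total domination number `γₜ`. -/
def totalDominationNumber : ℕ :=
  sInf {k | ∃ D : Finset (ℝ × ℝ), G.IsTDS D ∧ D.card = k}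

/-- Isomorphism of plane graphs as abstract graphs. -/
def IsIsoTo (H : PlaneGraph) : Prop :=
  ∃ f : ℝ × ℝ → ℝ × ℝ,
    Set.BijOn f (↑G.verts) (↑H.verts) ∧
    ∀ p ∈ G.verts, ∀ q ∈ G.verts, (G.Adj p q ↔ H.Adj (f p) (f q))

/-- The edge `(p, q)` is contractible: the contracted graph `G/e` is (abstractly isomorphic
to) a near-triangulation. -/
def IsContractible (p q : ℝ × ℝ) : Prop :=
  G.Adj p q ∧ ∃ H : PlaneGraph, H.IsNearTriangulation ∧ (G.contractEdge p q).IsIsoTo H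

/-- A separating triangle: a triangle of the graph with some vertex strictly inside it and
some vertex outside it. -/
def IsSeparatingTriangle (a b c : ℝ × ℝ) : Prop :=
  a ∈ G.verts ∧ b ∈ G.verts ∧ c ∈ G.verts ∧
  G.Adj a b ∧ G.Adj b c ∧ G.Adj a c ∧
  (∃ v ∈ G.verts, v ∈ openTriangle a b c) ∧
  (∃ v ∈ G.verts, v ∉ convexHull ℝ ({a, b, c} : Set (ℝ × ℝ)))

/-- Edge list of the first exceptional 12-vertex maximal outerplanar graph `H₁`
(boundary 12-cycle, central triangle `{0,4,8}`, ear triangles `{1,2,3}`, `{5,6,7}`,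
`{9,10,11}`, and the three remaining quadrilateral diagonals, all with the same
orientation). -/
def exc1Edges : List (Fin 12 × Fin 12) :=
  [(0,1),(1,2),(2,3),(3,4),(4,5),(5,6),(6,7),(7,8),(8,9),(9,10),(10,11),(11,0),
   (0,4),(4,8),(0,8),(1,3),(5,7),(9,11),(0,3),(4,7),(8,11)]

/-- Edge list of the second exceptional 12-vertex maximal outerplanar graph `H₂`
(same as `H₁` except that one quadrilateral diagonal has the opposite orientation). -/
def exc2Edges : List (Fin 12 × Fin 12) :=
  [(0,1),(1,2),(2,3),(3,4),(4,5),(5,6),(6,7),(7,8),(8,9),(9,10),(10,11),(11,0),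
   (0,4),(4,8),(0,8),(1,3),(5,7),(9,11),(0,3),(4,7),(0,9)]

/-- The exceptional graph `H₁`. -/
def H1graph : SimpleGraph (Fin 12) := SimpleGraph.fromRel (fun a b => (a, b) ∈ exc1Edges)

/-- The exceptional graph `H₂`. -/
def H2graph : SimpleGraph (Fin 12) := SimpleGraph.fromRel (fun a b => (a, b) ∈ exc2Edges)

/-- Isomorphism between a plane graph and a simple graph on `Fin 12`. -/
def IsIsoToSG (H : SimpleGraph (Fin 12)) : Prop :=
  ∃ f : ℝ × ℝ → Fin 12,
    Set.BijOn f (↑G.verts) Set.univ ∧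
    ∀ p ∈ G.verts, ∀ q ∈ G.verts, (G.Adj p q ↔ H.Adj (f p) (f q))

/-- `G` is isomorphic to `H₁` or to `H₂`. -/
def IsExceptional : Prop := G.IsIsoToSG H1graph ∨ G.IsIsoToSG H2graph

/-- A maximal outerplanar graph (MOP): a near-triangulation all of whose vertices lie on the
boundary cycle. -/
def IsMOP : Prop :=
  G.IsNearTriangulation ∧
    ∃ (h : ℕ) (u : ZMod h → ℝ × ℝ), G.IsBoundaryCycle u ∧ ∀ v ∈ G.verts, v ∈ Set.range u

/-- The graph is Hamiltonian: it has a cycle through all of its vertices. -/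
def IsHamiltonian : Prop :=
  ∃ (m : ℕ) (c : ZMod m → ℝ × ℝ), 3 ≤ m ∧ Function.Injective c ∧
    (∀ i, G.Adj (c i) (c (i + 1))) ∧ ∀ v ∈ G.verts, v ∈ Set.range c

/-- An outerplane graph: a properly embedded plane graph all of whose vertices lie on the
boundary of the outer region. -/
def IsOuterplane : Prop :=
  G.IsEmbedded ∧ ∀ v ∈ G.verts, (v : ℝ × ℝ) ∈ closure G.outerRegion

/-- The union of the boundary-cycle segments. -/
def boundaryDrawing {h : ℕ} (u : ZMod h → ℝ × ℝ) : Set (ℝ × ℝ) :=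
  ⋃ i : ZMod h, segment ℝ (u i) (u (i + 1))

/-- The open interior of the boundary cycle, viewed as a simple closed polygon. -/
def polygonInterior {h : ℕ} (u : ZMod h → ℝ × ℝ) : Set (ℝ × ℝ) :=
  {x | x ∉ boundaryDrawing u ∧
    Bornology.IsBounded (connectedComponentIn (boundaryDrawing u)ᶜ x)}

/-- The union of the segments realizing the diagonals of `G[C]`. -/
def diagonalDrawing {h : ℕ} (u : ZMod h → ℝ × ℝ) : Set (ℝ × ℝ) :=
  {x | ∃ i j : ZMod h, G.Adj (u i) (u j) ∧ j ≠ i + 1 ∧ i ≠ j + 1 ∧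
    x ∈ segment ℝ (u i) (u j)}

/-- A region of the subdivision of the interior of the boundary cycle by the diagonals of
`G[C]`: a connected component of the interior of the cycle minus the diagonals. -/
def IsSubdivisionRegion {h : ℕ} (u : ZMod h → ℝ × ℝ) (R : Set (ℝ × ℝ)) : Prop :=
  ∃ x ∈ polygonInterior u \ G.diagonalDrawing u,
    R = connectedComponentIn (polygonInterior u \ G.diagonalDrawing u) x

/-- The diagonal `(u i, u j)` is a side of the region `R`. -/
def IsSideOf {h : ℕ} (u : ZMod h → ℝ × ℝ) (R : Set (ℝ × ℝ)) (i j : ZMod h) : Prop :=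
  G.Adj (u i) (u j) ∧ j ≠ i + 1 ∧ i ≠ j + 1 ∧
    segment ℝ (u i) (u j) \ {u i, u j} ⊆ frontier R

/-- `v` lies on the opposite side of the diagonal `(u i, u j)` from the region `R`:
inside the boundary polygon, `v` cannot be joined to `R` without crossing the diagonal. -/
def OppositeSideOf {h : ℕ} (u : ZMod h → ℝ × ℝ) (R : Set (ℝ × ℝ)) (i j : ZMod h)
    (v : ℝ × ℝ) : Prop :=
  ∀ x ∈ R, v ∉ connectedComponentIn (polygonInterior u \ segment ℝ (u i) (u j)) x

/-- A terminal polygon: a region of the subdivision containing some interior vertex such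
that at most one of its sides has interior vertices of `G` on its opposite side
(i.e. at most one of the outer parts `T_out(P,d)` contains interior vertices). -/
def IsTerminalPolygon {h : ℕ} (u : ZMod h → ℝ × ℝ) (R : Set (ℝ × ℝ)) : Prop :=
  G.IsSubdivisionRegion u R ∧
  (∃ v, G.IsInteriorVtx u v ∧ v ∈ R) ∧
  ∀ i j k l : ZMod h,
    G.IsSideOf u R i j → G.IsSideOf u R k l →
    (∃ w, G.IsInteriorVtx u w ∧ OppositeSideOf u R i j w) →
    (∃ w, G.IsInteriorVtx u w ∧ OppositeSideOf u R k l w) →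
    ({u i, u j} : Set (ℝ × ℝ)) = {u k, u l}

/-- An irreducible near-triangulation: it has interior vertices, and for every boundary edge
`(u i, u (i+1))` the third vertex of the inner triangular face containing this edge also lies
on the boundary cycle. -/
def Irreducible {h : ℕ} (u : ZMod h → ℝ × ℝ) : Prop :=
  (∃ v, G.IsInteriorVtx u v) ∧
  ∀ i : ZMod h, ∀ v ∈ G.verts,
    G.Adj (u i) v → G.Adj (u (i + 1)) v →
    G.IsFace (openTriangle (u i) (u (i + 1)) v) → v ∈ Set.range u

end PlaneGraph

namespace PlaneGraph

section Geometry

open Set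

/-- Barycentric coordinates of the points of a triangle. -/
lemma mem_convexHull_triple_iff {E : Type*} [AddCommGroup E] [Module ℝ E] {a b c y : E} :
    y ∈ convexHull ℝ ({a, b, c} : Set E) ↔
      ∃ α β γ : ℝ, 0 ≤ α ∧ 0 ≤ β ∧ 0 ≤ γ ∧ α + β + γ = 1 ∧ α • a + β • b + γ • c = y := by
  rw [convexHull_insert (insert_nonempty _ _), convexHull_pair, mem_convexJoin]
  constructor
  · rintro ⟨_, rfl, z, ⟨s, t, hs, ht, hst, rfl⟩, ⟨p, q, hp, hq, hpq, rfl⟩⟩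
    refine ⟨p, q * s, q * t, hp, by positivity, by positivity, ?_, ?_⟩
    · linear_combination hpq + q * hst
    · module
  · rintro ⟨α, β, γ, hα, hβ, hγ, hsum, rfl⟩
    rcases (add_nonneg hβ hγ).eq_or_lt with h0 | h0
    · have hβ0 : β = 0 := by linarith
      have hγ0 : γ = 0 := by linarith
      have hα1 : α = 1 := by linarith
      subst hβ0 hγ0 hα1
      exact ⟨a, rfl, b, left_mem_segment ℝ b c, by simpa using left_mem_segment ℝ a b⟩
    · refine ⟨a, rfl, (β / (β + γ)) • b + (γ / (β + γ)) • c,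
        ⟨_, _, by positivity, by positivity, by field_simp, rfl⟩,
        ⟨α, β + γ, hα, h0.le, by linarith, ?_⟩⟩
      rw [smul_add, smul_smul, smul_smul, mul_div_cancel₀ _ h0.ne', mul_div_cancel₀ _ h0.ne',
        add_assoc]

/-- A point of a nondegenerate triangle is an interior point or lies on one of the sides. -/
lemma mem_interior_or_mem_side {E : Type*} [NormedAddCommGroup E] [NormedSpace ℝ E]
    {a b c y : E} (hne : (interior (convexHull ℝ ({a, b, c} : Set E))).Nonempty)
    (hy : y ∈ convexHull ℝ ({a, b, c} : Set E)) :
    y ∈ interior (convexHull ℝ ({a, b, c} : Set E)) ∨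
      y ∈ segment ℝ a b ∨ y ∈ segment ℝ b c ∨ y ∈ segment ℝ a c := by
  obtain ⟨α, β, γ, hα, hβ, hγ, hsum, rfl⟩ := mem_convexHull_triple_iff.1 hy
  rcases hα.eq_or_lt with rfl | hα
  · exact Or.inr (Or.inr (Or.inl ⟨β, γ, hβ, hγ, by linarith, by simp⟩))
  rcases hβ.eq_or_lt with rfl | hβ
  · exact Or.inr (Or.inr (Or.inr ⟨α, γ, hα.le, hγ, by linarith, by simp⟩))
  rcases hγ.eq_or_lt with rfl | hγ
  · exact Or.inr (Or.inl ⟨α, β, hα.le, hβ.le, by linarith, by simp⟩)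
  left
  obtain ⟨z, hz⟩ := hne
  obtain ⟨α', β', γ', hα', hβ', hγ', hsum', rfl⟩ :=
    mem_convexHull_triple_iff.1 (interior_subset hz)
  obtain ⟨δ, hδ, hδα, hδβ, hδγ⟩ : ∃ δ : ℝ, 0 < δ ∧ δ ≤ α ∧ δ ≤ β ∧ δ ≤ γ :=
    ⟨min α (min β γ), by simp [*], by simp, by simp, by simp⟩
  have hw : (α + δ * (α - α')) • a + (β + δ * (β - β')) • b + (γ + δ * (γ - γ')) • c ∈
      convexHull ℝ ({a, b, c} : Set E) := by
    refine mem_convexHull_triple_iff.2 ⟨_, _, _, ?_, ?_, ?_, ?_, rfl⟩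
    · nlinarith
    · nlinarith
    · nlinarith
    · linear_combination (1 + δ) * hsum - δ * hsum'
  refine (convex_convexHull ℝ _).openSegment_interior_self_subset_interior hz hw
    ⟨δ / (1 + δ), 1 / (1 + δ), by positivity, by positivity, by field_simp; ring, ?_⟩
  match_scalars <;> field_simp <;> ring

/-- A triangle in the plane either has interior points or has a corner on the opposite side. -/
lemma interior_nonempty_or_mem_opposite_side (a b c : ℝ × ℝ) :
    (interior (convexHull ℝ ({a, b, c} : Set (ℝ × ℝ)))).Nonempty ∨
      b ∈ segment ℝ a c ∨ c ∈ segment ℝ b a ∨ a ∈ segment ℝ c b := by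
  by_cases hcol : Collinear ℝ ({a, b, c} : Set (ℝ × ℝ))
  · right
    simpa only [mem_segment_iff_wbtw] using hcol.wbtw_or_wbtw_or_wbtw
  · left
    have hind := affineIndependent_iff_not_collinear_set.2 hcol
    rw [interior_convexHull_nonempty_iff_affineSpan_eq_top]
    have htop := hind.affineSpan_eq_top_iff_card_eq_finrank_add_one.2 (by simp)
    have hr : range ![a, b, c] = {a, b, c} := by
      ext y
      simp [eq_comm]
      tauto
    rwa [hr] at htop

/-- Radon's theorem for four points of the plane. -/
lemma radon_four_points (a b c d : ℝ × ℝ) :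
    d ∈ convexHull ℝ ({a, b, c} : Set (ℝ × ℝ)) ∨ c ∈ convexHull ℝ ({a, b, d} : Set (ℝ × ℝ)) ∨
      b ∈ convexHull ℝ ({a, c, d} : Set (ℝ × ℝ)) ∨ a ∈ convexHull ℝ ({b, c, d} : Set (ℝ × ℝ)) ∨
      (segment ℝ a b ∩ segment ℝ c d).Nonempty ∨ (segment ℝ a c ∩ segment ℝ b d).Nonempty ∨
      (segment ℝ a d ∩ segment ℝ b c).Nonempty := by
  have hdep : ¬ AffineIndependent ℝ ![a, b, c, d] := fun hind => by
    have := hind.card_le_finrank_succ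
    have h2 := Submodule.finrank_le (vectorSpan ℝ (range ![a, b, c, d]))
    simp only [Fintype.card_fin, Module.finrank_prod, Module.finrank_self] at this h2
    omega
  obtain ⟨I, x, hx, hx'⟩ := Convex.radon_partition hdep
  have himage : ∀ J : Set (Fin 4), ![a, b, c, d] '' J =
      {y | (0 ∈ J ∧ y = a) ∨ (1 ∈ J ∧ y = b) ∨ (2 ∈ J ∧ y = c) ∨ (3 ∈ J ∧ y = d)} := by
    intro J
    ext y
    simp [Fin.exists_fin_succ, eq_comm]
  rw [himage] at hx hx'
  simp only [← convexHull_pair]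
  by_cases h0 : (0 : Fin 4) ∈ I <;> by_cases h1 : (1 : Fin 4) ∈ I <;>
    by_cases h2 : (2 : Fin 4) ∈ I <;> by_cases h3 : (3 : Fin 4) ∈ I <;>
    simp only [h0, h1, h2, h3, mem_compl_iff, not_true, not_false_iff, true_and, false_and,
      or_false, false_or, ofPred_false, ofPred_eq_eq_singleton, convexHull_empty,
      convexHull_singleton, mem_singleton_iff, mem_empty_iff_false] at hx hx' <;>
    first
    | (subst hx; tauto)
    | (subst hx'; tauto)
    | exact .inr (.inr (.inr (.inr (.inl ⟨x, hx, hx'⟩))))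
    | exact .inr (.inr (.inr (.inr (.inl ⟨x, hx', hx⟩))))
    | exact .inr (.inr (.inr (.inr (.inr (.inl ⟨x, hx, hx'⟩)))))
    | exact .inr (.inr (.inr (.inr (.inr (.inl ⟨x, hx', hx⟩)))))
    | exact .inr (.inr (.inr (.inr (.inr (.inr ⟨x, hx, hx'⟩)))))
    | exact .inr (.inr (.inr (.inr (.inr (.inr ⟨x, hx', hx⟩)))))

lemma isClosed_drawing (G : PlaneGraph) : IsClosed G.drawing := by
  have hfin : {e : (ℝ × ℝ) × (ℝ × ℝ) | G.Adj e.1 e.2}.Finite :=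
    ((G.verts ×ˢ G.verts).finite_toSet).subset fun e he => by
      simpa using G.mem_of_adj _ _ he
  have hEq : G.drawing =
      ⋃ e ∈ {e : (ℝ × ℝ) × (ℝ × ℝ) | G.Adj e.1 e.2}, segment ℝ e.1 e.2 := by
    ext x
    simp [drawing]
  rw [hEq]
  refine hfin.isClosed_biUnion fun e _ => ?_
  rw [← convexHull_pair]
  exact (Set.Finite.isCompact_convexHull (𝕜 := ℝ) (Set.toFinite _)).isClosed

lemma isClosed_triangle (a b c : ℝ × ℝ) :
    IsClosed (convexHull ℝ ({a, b, c} : Set (ℝ × ℝ))) :=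
  (Set.Finite.isCompact_convexHull (𝕜 := ℝ) (Set.toFinite _)).isClosed

/-- A face containing a point inside a triangle of the graph lies inside that triangle. -/
lemma connectedComponentIn_subset_openTriangle {G : PlaneGraph} {a b c x : ℝ × ℝ}
    (hab : G.Adj a b) (hbc : G.Adj b c) (hac : G.Adj a c) (hx : x ∈ openTriangle a b c) :
    connectedComponentIn G.drawingᶜ x ⊆ openTriangle a b c := by
  by_cases hxd : x ∈ G.drawingᶜ
  swap
  · simp [connectedComponentIn_eq_empty hxd]
  refine isPreconnected_connectedComponentIn.subset_left_of_subset_union isOpen_interior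
    (isClosed_triangle a b c).isOpen_compl
    (disjoint_compl_right.mono_left interior_subset) ?_ ⟨x, mem_connectedComponentIn hxd, hx⟩
  intro y hy
  have hyd : y ∉ G.drawing := connectedComponentIn_subset _ _ hy
  by_cases hyT : y ∈ convexHull ℝ ({a, b, c} : Set (ℝ × ℝ))
  · refine Or.inl ((mem_interior_or_mem_side ⟨x, hx⟩ hyT).resolve_right ?_)
    rintro (h | h | h)
    exacts [hyd ⟨_, _, hab, h⟩, hyd ⟨_, _, hbc, h⟩, hyd ⟨_, _, hac, h⟩]
  · exact Or.inr hyT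

lemma isBounded_openTriangle (a b c : ℝ × ℝ) : Bornology.IsBounded (openTriangle a b c) :=
  (Set.Finite.isCompact_convexHull (𝕜 := ℝ) (Set.toFinite _)).isBounded.subset interior_subset

/-- The boundary of the outer region avoids the inside of every triangle of the graph. -/
lemma notMem_frontier_outerRegion {G : PlaneGraph} {a b c x : ℝ × ℝ}
    (hab : G.Adj a b) (hbc : G.Adj b c) (hac : G.Adj a c) (hx : x ∈ openTriangle a b c) :
    x ∉ frontier G.outerRegion := by
  intro hxf
  obtain ⟨y, hyT, -, hyB⟩ :=
    mem_closure_iff.1 (frontier_subset_closure hxf) _ isOpen_interior hx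
  exact hyB ((isBounded_openTriangle a b c).subset
    (connectedComponentIn_subset_openTriangle hab hbc hac hyT))

lemma IsEmbedded.eq_or_eq {G : PlaneGraph} (hG : G.IsEmbedded) {p q r s x : ℝ × ℝ}
    (hpq : G.Adj p q) (hrs : G.Adj r s) (hx : x ∈ segment ℝ p q) (hx' : x ∈ segment ℝ r s)
    (hxp : x ≠ p) (hxq : x ≠ q) : (r = p ∧ s = q) ∨ (r = q ∧ s = p) := by
  rcases hG.1 p q r s hpq hrs x hx hx' with h | ⟨h, -⟩
  · have hr : r ∈ ({p, q} : Set (ℝ × ℝ)) := h ▸ by simp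
    have hs : s ∈ ({p, q} : Set (ℝ × ℝ)) := h ▸ by simp
    have hne : r ≠ s := fun h => G.loopless _ (h ▸ hrs)
    simp only [mem_insert_iff, mem_singleton_iff] at hr hs
    grind
  · simp [hxp, hxq] at h

/-- Three pairwise adjacent vertices of an embedded graph span a nondegenerate triangle. -/
lemma IsEmbedded.openTriangle_nonempty {G : PlaneGraph} (hG : G.IsEmbedded) {a b c : ℝ × ℝ}
    (hab : G.Adj a b) (hbc : G.Adj b c) (hac : G.Adj a c) : (openTriangle a b c).Nonempty := by
  have hne : ∀ {p q}, G.Adj p q → p ≠ q := fun h h' => G.loopless _ (h' ▸ h)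
  rcases interior_nonempty_or_mem_opposite_side a b c with h | h | h | h
  · exact h
  · rcases hG.2 _ _ _ hac (G.mem_of_adj _ _ hab).2 h with h | h
    exacts [absurd h.symm (hne hab), absurd h (hne hbc)]
  · rcases hG.2 _ _ _ (G.symm _ _ hab) (G.mem_of_adj _ _ hac).2 h with h | h
    exacts [absurd h.symm (hne hbc), absurd h.symm (hne hac)]
  · rcases hG.2 _ _ _ (G.symm _ _ hbc) (G.mem_of_adj _ _ hab).1 h with h | h
    exacts [absurd h (hne hac), absurd h (hne hab)]

/-- A further vertex lying in a closed triangle of an embedded graph lies in its interior. -/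
lemma IsEmbedded.mem_openTriangle {G : PlaneGraph} (hG : G.IsEmbedded) {a b c v : ℝ × ℝ}
    (hab : G.Adj a b) (hbc : G.Adj b c) (hac : G.Adj a c) (hv : v ∈ G.verts)
    (hva : v ≠ a) (hvb : v ≠ b) (hvc : v ≠ c)
    (hvT : v ∈ convexHull ℝ ({a, b, c} : Set (ℝ × ℝ))) : v ∈ openTriangle a b c := by
  refine (mem_interior_or_mem_side (hG.openTriangle_nonempty hab hbc hac) hvT).resolve_right ?_
  rintro (h | h | h)
  · exact (hG.2 _ _ _ hab hv h).elim hva hvb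
  · exact (hG.2 _ _ _ hbc hv h).elim hvb hvc
  · exact (hG.2 _ _ _ hac hv h).elim hva hvc

/-- If the edge `a b` of a complete subgraph on four vertices lies on the outer boundary, then
one of the other two vertices is enclosed by the remaining three. -/
lemma IsEmbedded.mem_openTriangle_of_complete_four {G : PlaneGraph} (hG : G.IsEmbedded)
    {a b c d : ℝ × ℝ} (hab : G.Adj a b) (hac : G.Adj a c) (had : G.Adj a d) (hbc : G.Adj b c)
    (hbd : G.Adj b d) (hcd : G.Adj c d) (hout : segment ℝ a b ⊆ frontier G.outerRegion) :
    d ∈ openTriangle a b c ∨ c ∈ openTriangle a b d := by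
  have hne : ∀ {p q}, G.Adj p q → p ≠ q := fun h h' => G.loopless _ (h' ▸ h)
  have hcross : ∀ {p q r s}, G.Adj p q → G.Adj r s → p ≠ r → p ≠ s → q ≠ r → q ≠ s →
      ¬ (segment ℝ p q ∩ segment ℝ r s).Nonempty := by
    rintro p q r s hpq hrs h1 h2 h3 h4 ⟨x, hx, hx'⟩
    rcases hG.1 p q r s hpq hrs x hx hx' with h | ⟨h, h'⟩
    · have hp : p ∈ ({r, s} : Set (ℝ × ℝ)) := h ▸ by simp
      simp [h1, h2] at hp
    · simp only [mem_insert_iff, mem_singleton_iff] at h h'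
      grind
  have nab := hne hab
  have nac := hne hac
  have nad := hne had
  have nbc := hne hbc
  have nbd := hne hbd
  have ncd := hne hcd
  rcases radon_four_points a b c d with h | h | h | h | h | h | h
  · exact Or.inl (hG.mem_openTriangle hab hbc hac (G.mem_of_adj _ _ hcd).2
      nad.symm nbd.symm ncd.symm h)
  · exact Or.inr (hG.mem_openTriangle hab hbd had (G.mem_of_adj _ _ hcd).1
      nac.symm nbc.symm ncd h)
  · exact absurd (hout (right_mem_segment ℝ a b)) (notMem_frontier_outerRegion hac hcd had
      (hG.mem_openTriangle hac hcd had (G.mem_of_adj _ _ hab).2 nab.symm nbc nbd h))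
  · exact absurd (hout (left_mem_segment ℝ a b)) (notMem_frontier_outerRegion hbc hcd hbd
      (hG.mem_openTriangle hbc hcd hbd (G.mem_of_adj _ _ hab).1 nab nac nad h))
  · exact absurd h (hcross hab hcd nac nad nbc nbd)
  · exact absurd h (hcross hac hbd nab nad nbc.symm ncd)
  · exact absurd h (hcross had hbc nab nac nbd.symm ncd.symm)

/-- A triangular face whose closure contains an inner point of an edge has that edge as a
side. -/
lemma IsEmbedded.exists_opposite_vertex {G : PlaneGraph} (hG : G.IsEmbedded)
    {a b c p q x : ℝ × ℝ} (hab : G.Adj a b) (hbc : G.Adj b c) (hac : G.Adj a c)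
    (hface : Disjoint (openTriangle a b c) G.drawing) (hpq : G.Adj p q)
    (hx : x ∈ segment ℝ p q) (hxp : x ≠ p) (hxq : x ≠ q)
    (hxc : x ∈ closure (openTriangle a b c)) :
    ∃ r, G.Adj p r ∧ G.Adj q r ∧ openTriangle a b c = openTriangle p q r := by
  have hxT : x ∈ convexHull ℝ ({a, b, c} : Set (ℝ × ℝ)) :=
    closure_minimal interior_subset (isClosed_triangle a b c) hxc
  have hxI : x ∉ openTriangle a b c := fun h => hface.le_bot ⟨h, p, q, hpq, hx⟩
  have hba := G.symm _ _ hab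
  have hcb := G.symm _ _ hbc
  have hca := G.symm _ _ hac
  rcases (mem_interior_or_mem_side (hG.openTriangle_nonempty hab hbc hac) hxT).resolve_left hxI
    with h | h | h
  · rcases hG.eq_or_eq hpq hab hx h hxp hxq with ⟨rfl, rfl⟩ | ⟨rfl, rfl⟩
    · exact ⟨c, hac, hbc, rfl⟩
    · exact ⟨c, hbc, hac, by rw [openTriangle, openTriangle, insert_comm]⟩
  · rcases hG.eq_or_eq hpq hbc hx h hxp hxq with ⟨rfl, rfl⟩ | ⟨rfl, rfl⟩
    · exact ⟨a, hba, hca, by rw [openTriangle, openTriangle]; congr 2; grind⟩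
    · exact ⟨a, hca, hba, by rw [openTriangle, openTriangle]; congr 2; grind⟩
  · rcases hG.eq_or_eq hpq hac hx h hxp hxq with ⟨rfl, rfl⟩ | ⟨rfl, rfl⟩
    · exact ⟨b, hab, hcb, by rw [openTriangle, openTriangle]; congr 2; grind⟩
    · exact ⟨b, hcb, hab, by rw [openTriangle, openTriangle]; congr 2; grind⟩

/-- Near an inner point of an edge of an embedded graph, the transversal direction avoids the
drawing. -/
lemma IsEmbedded.exists_transversal {G : PlaneGraph} (hG : G.IsEmbedded) {p q x : ℝ × ℝ}
    (hpq : G.Adj p q) (hx : x ∈ segment ℝ p q) (hxp : x ≠ p) (hxq : x ≠ q) {U : Set (ℝ × ℝ)}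
    (hU : IsOpen U) (hxU : x ∈ U) :
    ∃ n : ℝ × ℝ, ∀ t : ℝ, |t| ≤ 1 → x + t • n ∈ U ∧ (t ≠ 0 → x + t • n ∉ G.drawing) := by
  have hxd : x ∉ (G.deleteEdge p q).drawing := by
    rintro ⟨r, s, ⟨hrs, hne⟩, hxrs⟩
    exact hne (hG.eq_or_eq hpq hrs hx hxrs hxp hxq)
  obtain ⟨ε, hε, hball⟩ := Metric.isOpen_iff.1
    (hU.inter (isClosed_drawing (G.deleteEdge p q)).isOpen_compl) x ⟨hxU, hxd⟩
  set m : ℝ × ℝ := (-(q.2 - p.2), q.1 - p.1) with hm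
  have hm0 : m ≠ 0 := by
    intro h0
    simp only [hm, Prod.mk_eq_zero] at h0
    exact G.loopless p ((Prod.ext (by linarith) (by linarith) : q = p) ▸ hpq)
  set δ : ℝ := ε / (2 * ‖m‖) with hδ
  have hmpos : 0 < ‖m‖ := norm_pos_iff.2 hm0
  have hδpos : 0 < δ := by positivity
  refine ⟨δ • m, fun t ht => ?_⟩
  have hmem : x + t • δ • m ∈ Metric.ball x ε := by
    rw [mem_ball_iff_norm, add_sub_cancel_left, norm_smul, norm_smul, Real.norm_eq_abs,
      Real.norm_of_nonneg hδpos.le, hδ]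
    have : ε / (2 * ‖m‖) * ‖m‖ = ε / 2 := by field_simp
    rw [this]
    nlinarith
  refine ⟨(hball hmem).1, fun ht0 => ?_⟩
  rintro ⟨r, s, hrs, hy⟩
  by_cases he : (r = p ∧ s = q) ∨ (r = q ∧ s = p)
  · have hy' : x + t • δ • m ∈ segment ℝ p q := by
      rcases he with ⟨rfl, rfl⟩ | ⟨rfl, rfl⟩
      exacts [hy, segment_symm ℝ r s ▸ hy]
    rw [segment_eq_image'] at hx hy'
    obtain ⟨α, -, hα⟩ := hx
    obtain ⟨β, -, hβ⟩ := hy'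
    have h1 := congrArg Prod.fst hβ
    have h2 := congrArg Prod.snd hβ
    rw [← hα] at h1 h2
    simp only [hm, Prod.fst_add, Prod.snd_add, Prod.smul_fst, Prod.smul_snd, Prod.fst_sub,
      Prod.snd_sub, smul_eq_mul] at h1 h2
    have hsq : t * δ * ((q.1 - p.1) ^ 2 + (q.2 - p.2) ^ 2) = 0 := by
      linear_combination (q.2 - p.2) * h1 - (q.1 - p.1) * h2
    have hpos : 0 < (q.1 - p.1) ^ 2 + (q.2 - p.2) ^ 2 := by
      by_contra hle
      apply hm0
      rw [hm, Prod.mk_eq_zero]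
      constructor <;> nlinarith [sq_nonneg (q.1 - p.1), sq_nonneg (q.2 - p.2)]
    exact mul_ne_zero (mul_ne_zero ht0 hδpos.ne') hpos.ne' hsq
  · exact (hball hmem).2 ⟨r, s, ⟨hrs, he⟩, hy⟩

/-- An edge of a near-triangulation with an end inside a triangle of the graph is a side of
two triangles. -/
lemma IsNearTriangulation.exists_two_common_neighbors {G : PlaneGraph}
    (hG : G.IsNearTriangulation) {a b c p q : ℝ × ℝ} (hab : G.Adj a b) (hbc : G.Adj b c)
    (hac : G.Adj a c) (hp : p ∈ openTriangle a b c) (hpq : G.Adj p q) :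
    ∃ r s, r ≠ s ∧ G.Adj p r ∧ G.Adj q r ∧ G.Adj p s ∧ G.Adj q s := by
  obtain ⟨hE, -, hF⟩ := hG
  have hpne : q - p ≠ 0 := fun h => G.loopless p (sub_eq_zero.1 h ▸ hpq)
  obtain ⟨x, hx, hxT, hxp, hxq⟩ :
      ∃ x ∈ segment ℝ p q, x ∈ openTriangle a b c ∧ x ≠ p ∧ x ≠ q := by
    have hcont : Filter.Tendsto (fun t : ℝ => p + t • (q - p)) (nhdsWithin 0 (Ioi 0))
        (nhds p) := by
      have : Continuous fun t : ℝ => p + t • (q - p) := by fun_prop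
      simpa using (this.tendsto 0).mono_left nhdsWithin_le_nhds
    obtain ⟨t, htT, ht0, ht1⟩ := ((hcont.eventually (isOpen_interior.mem_nhds hp)).and
      (Ioo_mem_nhdsGT (zero_lt_one' ℝ))).exists
    refine ⟨_, by rw [segment_eq_image']; exact ⟨t, ⟨ht0.le, ht1.le⟩, rfl⟩, htT, ?_, ?_⟩
    · simp [ht0.ne', hpne]
    · intro h
      have : (1 - t) • (q - p) = 0 := by
        have hm : (1 - t) • (q - p) = q - (p + t • (q - p)) := by module
        rw [hm, h, sub_self]
      rcases smul_eq_zero.1 this with h | h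
      exacts [absurd h (by linarith), hpne h]
  obtain ⟨n, hn⟩ := hE.exists_transversal hpq hx hxp hxq isOpen_interior hxT
  have hside : ∀ σ : ℝ, |σ| = 1 → ∃ r, G.Adj p r ∧ G.Adj q r ∧
      x + σ • n ∈ openTriangle p q r ∧ Disjoint (openTriangle p q r) G.drawing := by
    intro σ hσ
    have hσ0 : σ ≠ 0 := by rintro rfl; simp at hσ
    obtain ⟨hyT, hyd⟩ := hn σ hσ.le
    have hyd := hyd hσ0
    obtain ⟨a', -, b', -, c', -, hab', hbc', hac', hFe⟩ := hF _ ⟨_, hyd, rfl⟩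
      ((isBounded_openTriangle a b c).subset
        (connectedComponentIn_subset_openTriangle hab hbc hac hyT))
    have hdisj : Disjoint (openTriangle a' b' c') G.drawing := by
      rw [← hFe, ← subset_compl_iff_disjoint_right]
      exact connectedComponentIn_subset _ _
    have hray : (fun t : ℝ => x + t • σ • n) '' Ioc 0 1 ⊆ openTriangle a' b' c' := by
      rw [← hFe]
      refine IsPreconnected.subset_connectedComponentIn
        (isPreconnected_Ioc.image _ (by fun_prop)) ⟨1, by simp, by simp⟩ ?_
      rintro _ ⟨t, ⟨ht0, ht1⟩, rfl⟩
      have := hn (t * σ) (by rw [abs_mul, hσ, abs_of_pos ht0]; linarith)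
      simpa [mul_smul] using this.2 (mul_ne_zero ht0.ne' hσ0)
    have hxcl : x ∈ closure (openTriangle a' b' c') := by
      have hcont : Filter.Tendsto (fun t : ℝ => x + t • σ • n) (nhdsWithin 0 (Ioi 0))
          (nhds x) := by
        have : Continuous fun t : ℝ => x + t • σ • n := by fun_prop
        simpa using (this.tendsto 0).mono_left nhdsWithin_le_nhds
      refine mem_closure_of_tendsto hcont ?_
      filter_upwards [Ioc_mem_nhdsGT (zero_lt_one' ℝ)] with t ht
      exact hray ⟨t, ht, rfl⟩
    obtain ⟨r, hpr, hqr, hEq⟩ :=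
      hE.exists_opposite_vertex hab' hbc' hac' hdisj hpq hx hxp hxq hxcl
    refine ⟨r, hpr, hqr, ?_, hEq ▸ hdisj⟩
    rw [← hEq]
    exact hray ⟨1, by simp, by simp⟩
  obtain ⟨r, hpr, hqr, hr, hdisj⟩ := hside 1 (by simp)
  obtain ⟨s, hps, hqs, hs, -⟩ := hside (-1) (by simp)
  refine ⟨r, s, ?_, hpr, hqr, hps, hqs⟩
  rintro rfl
  refine hdisj.le_bot ⟨?_, p, q, hpq, hx⟩
  have := (convex_convexHull ℝ ({p, q, r} : Set (ℝ × ℝ))).interior hr hs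
    (a := 1 / 2) (b := 1 / 2) (by norm_num) (by norm_num) (by norm_num)
  have hmid : (1 / 2 : ℝ) • (x + (1 : ℝ) • n) + (1 / 2 : ℝ) • (x + (-1 : ℝ) • n) = x := by
    module
  rwa [hmid] at this

end Geometry

section Combinatorics

/-- Adjacency of two vertices in the graph with the given edge list. -/
def edgeListAdj (l : List (Fin 12 × Fin 12)) (x y : Fin 12) : Bool :=
  l.contains (x, y) || l.contains (y, x)

/-- The pair `c, d` witnesses that the edge `a b` cannot lie on the outer boundary of a
near-triangulation with the given edge list: the vertices `a, b, c, d` are pairwise adjacent,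
but `c` and `d` both have an incident edge which is a side of at most one triangle. -/
def IsObstruction (l : List (Fin 12 × Fin 12)) (a b c d : Fin 12) : Prop :=
  edgeListAdj l a c ∧ edgeListAdj l a d ∧ edgeListAdj l b c ∧ edgeListAdj l b d ∧
    edgeListAdj l c d ∧ ∀ v, v = c ∨ v = d → ∃ w, edgeListAdj l v w ∧ ∀ r, edgeListAdj l v r →
      edgeListAdj l w r → ∀ s, edgeListAdj l v s → edgeListAdj l w s → r = s

/-- `D` is a total dominating set of size four meeting `{a, b}` in the graph with the given
edge list. -/
def IsSmallDominator (l : List (Fin 12 × Fin 12)) (a b : Fin 12) (D : List (Fin 12)) : Prop :=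
  D.Nodup ∧ D.length = 4 ∧ (a ∈ D ∨ b ∈ D) ∧ ∀ v, ∃ d ∈ D, edgeListAdj l v d

instance (l : List (Fin 12 × Fin 12)) (a b c d : Fin 12) : Decidable (IsObstruction l a b c d) := by
  unfold IsObstruction; infer_instance

instance (l : List (Fin 12 × Fin 12)) (a b : Fin 12) (D : List (Fin 12)) :
    Decidable (IsSmallDominator l a b D) := by
  unfold IsSmallDominator; infer_instance

lemma exc1Edges_dominator_or_obstruction : ∀ a b, a ≠ b → edgeListAdj exc1Edges a b = false →
    (∃ D ∈ [[0, 4, 5, 11], [0, 1, 4, 11], [0, 1, 7, 8], [0, 7, 8, 9], [0, 1, 5, 11], [0, 1, 7, 11],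
      [3, 4, 8, 9], [3, 7, 8, 9], [3, 4, 5, 8], [1, 7, 8, 9], [3, 4, 5, 9], [3, 4, 5, 11],
      [0, 5, 6, 11], [0, 3, 5, 11], [1, 7, 8, 11], [1, 2, 7, 8], [3, 4, 9, 10], [3, 4, 7, 9]],
      IsSmallDominator ((a, b) :: exc1Edges) a b D) ∨
    ∃ c d, IsObstruction ((a, b) :: exc1Edges) a b c d := by
  decide +kernel

lemma exc2Edges_dominator_or_obstruction : ∀ a b, a ≠ b → edgeListAdj exc2Edges a b = false →
    (∃ D ∈ [[0, 4, 5, 9], [0, 1, 4, 9], [0, 1, 4, 5], [0, 6, 7, 11], [0, 1, 5, 9], [0, 1, 7, 9],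
      [0, 3, 6, 7], [3, 7, 8, 9], [3, 4, 5, 11], [0, 3, 4, 11], [1, 7, 8, 9], [0, 7, 8, 9],
      [0, 3, 5, 9], [0, 1, 7, 11], [0, 1, 7, 8], [1, 4, 5, 11], [2, 4, 5, 10], [3, 4, 8, 9],
      [3, 4, 5, 9]],
      IsSmallDominator ((a, b) :: exc2Edges) a b D) ∨
    ∃ c d, IsObstruction ((a, b) :: exc2Edges) a b c d := by
  decide +kernel

end Combinatorics

/-- An outer edge of a near-triangulation given by an edge list has no obstruction. -/
lemma IsNearTriangulation.not_isObstruction {G : PlaneGraph} (hG : G.IsNearTriangulation)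
    {l : List (Fin 12 × Fin 12)} {f : ℝ × ℝ → Fin 12} {g : Fin 12 → ℝ × ℝ}
    (hgf : ∀ p ∈ G.verts, g (f p) = p)
    (hadj : ∀ x y, G.Adj (g x) (g y) ↔ edgeListAdj l x y) {a b : Fin 12}
    (hab : G.Adj (g a) (g b)) (hout : segment ℝ (g a) (g b) ⊆ frontier G.outerRegion)
    (c d : Fin 12) : ¬ IsObstruction l a b c d := by
  rintro ⟨hac, had, hbc, hbd, hcd, hside⟩
  simp only [← hadj] at hac had hbc hbd hcd hside
  obtain ⟨v, hv, z, hz, hzb, hza⟩ : ∃ v, (v = c ∨ v = d) ∧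
      ∃ z, g v ∈ openTriangle (g a) (g b) z ∧ G.Adj (g b) z ∧ G.Adj (g a) z := by
    rcases hG.1.mem_openTriangle_of_complete_four hab hac had hbc hbd hcd hout with h | h
    exacts [⟨d, .inr rfl, _, h, hbc, hac⟩, ⟨c, .inl rfl, _, h, hbd, had⟩]
  obtain ⟨w, hvw, huniq⟩ := hside v hv
  obtain ⟨r, s, hrs, hvr, hwr, hvs, hws⟩ := hG.exists_two_common_neighbors hab hzb hza hz hvw
  have hr := hgf r (G.mem_of_adj _ _ hvr).2
  have hs := hgf s (G.mem_of_adj _ _ hvs).2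
  rw [← hr] at hvr hwr
  rw [← hs] at hvs hws
  exact hrs (by rw [← hr, ← hs, huniq _ hvr hwr _ hvs hws])

/-- A four-element total dominating set of an edge list yields one of the plane graph. -/
lemma exists_isTDS_of_isSmallDominator {G : PlaneGraph} {l : List (Fin 12 × Fin 12)}
    {f : ℝ × ℝ → Fin 12} {g : Fin 12 → ℝ × ℝ} (hfg : ∀ x, f (g x) = x)
    (hgf : ∀ p ∈ G.verts, g (f p) = p) (hg : ∀ x, g x ∈ G.verts)
    (hadj : ∀ x y, G.Adj (g x) (g y) ↔ edgeListAdj l x y) {a b : Fin 12} {D : List (Fin 12)}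
    (hD : IsSmallDominator l a b D) :
    ∃ S : Finset (ℝ × ℝ), G.IsTDS S ∧ S.card = 4 ∧ (g a ∈ S ∨ g b ∈ S) := by
  obtain ⟨hnodup, hlen, hmem, hdom⟩ := hD
  have hinj : Function.Injective g := Function.LeftInverse.injective hfg
  refine ⟨D.toFinset.image g, ⟨?_, fun v hv => ?_⟩, ?_, ?_⟩
  · intro p hp
    obtain ⟨x, -, rfl⟩ := Finset.mem_image.1 hp
    exact hg x
  · obtain ⟨d, hd, hvd⟩ := hdom (f v)
    refine ⟨g d, Finset.mem_image_of_mem _ (List.mem_toFinset.2 hd), ?_⟩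
    rw [← hadj, hgf v hv] at hvd
    exact hvd
  · rw [Finset.card_image_of_injective _ hinj, List.toFinset_card_of_nodup hnodup, hlen]
  · simpa [hinj.eq_iff] using hmem

/-- The conclusion for a graph which becomes isomorphic to a given graph when an outer edge is
deleted, provided every way of adding an edge to the latter gives a small total dominating set
or an obstruction. -/
lemma IsNearTriangulation.exists_isTDS_of_deleteEdge {G : PlaneGraph}
    (hG : G.IsNearTriangulation) {l : List (Fin 12 × Fin 12)} (hl : ∀ e ∈ l, e.1 ≠ e.2)
    (halt : ∀ a b, a ≠ b → edgeListAdj l a b = false →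
      (∃ D, IsSmallDominator ((a, b) :: l) a b D) ∨
        ∃ c d, IsObstruction ((a, b) :: l) a b c d)
    {p q : ℝ × ℝ} (hpq : G.Adj p q) (hout : segment ℝ p q ⊆ frontier G.outerRegion)
    (hiso : (G.deleteEdge p q).IsIsoToSG (SimpleGraph.fromRel fun a b => (a, b) ∈ l)) :
    ∃ D : Finset (ℝ × ℝ), G.IsTDS D ∧ D.card = 4 ∧ (p ∈ D ∨ q ∈ D) := by
  obtain ⟨f, hbij, hf⟩ := hiso
  obtain ⟨hp, hq⟩ := G.mem_of_adj _ _ hpq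
  have hadjf : ∀ x ∈ G.verts, ∀ y ∈ G.verts,
      (G.deleteEdge p q).Adj x y ↔ edgeListAdj l (f x) (f y) := by
    intro x hx y hy
    rw [hf x hx y hy, SimpleGraph.fromRel_adj]
    simp only [edgeListAdj, Bool.or_eq_true, List.contains_iff_mem, and_iff_right_iff_imp]
    rintro (h | h)
    exacts [hl _ h, (hl _ h).symm]
  have hex : ∀ x, ∃ v ∈ G.verts, f v = x := fun x => hbij.surjOn (Set.mem_univ x)
  choose g hg hfg using hex
  have hgf : ∀ v ∈ G.verts, g (f v) = v := fun v hv => hbij.injOn (hg _) hv (hfg _)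
  have hne : f p ≠ f q := fun h => G.loopless p ((hbij.injOn hp hq h).symm ▸ hpq)
  have hnadj : edgeListAdj l (f p) (f q) = false := by
    rw [← Bool.not_eq_true, ← hadjf p hp q hq]
    exact fun h => h.2 (Or.inl ⟨rfl, rfl⟩)
  have hadj : ∀ x y, G.Adj (g x) (g y) ↔ edgeListAdj ((f p, f q) :: l) x y := by
    intro x y
    have hx : ∀ v ∈ G.verts, ∀ z, g z = v ↔ z = f v := fun v hv z =>
      ⟨fun h => by rw [← h, hfg], fun h => by rw [h, hgf v hv]⟩
    have h1 := hadjf _ (hg x) _ (hg y)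
    simp only [deleteEdge, hfg, hx p hp, hx q hq, edgeListAdj, Bool.or_eq_true,
      List.contains_iff_mem] at h1
    simp only [edgeListAdj, Bool.or_eq_true, List.contains_iff_mem, List.mem_cons,
      Prod.mk.injEq]
    have h2 : x = f p ∧ y = f q → G.Adj (g x) (g y) := by
      rintro ⟨rfl, rfl⟩
      rwa [hgf p hp, hgf q hq]
    have h3 : x = f q ∧ y = f p → G.Adj (g x) (g y) := by
      rintro ⟨rfl, rfl⟩
      rw [hgf p hp, hgf q hq]
      exact G.symm _ _ hpq
    tauto
  rcases halt _ _ hne hnadj with ⟨D, hD⟩ | ⟨c, d, hcd⟩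
  · simpa only [hgf p hp, hgf q hq] using exists_isTDS_of_isSmallDominator hfg hgf hg hadj hD
  · refine absurd hcd (hG.not_isObstruction hgf hadj ?_ ?_ c d)
    · rwa [hgf p hp, hgf q hq]
    · rwa [hgf p hp, hgf q hq]

end PlaneGraph

/-- Let `T` be a near-triangulation with boundary cycle
`C = (u_1, …, u_h, u_1)` and let `e_i = (u_i, u_{i+1})` be a boundary edge of `T`.  If
`T − e_i` is isomorphic to `H₁` or `H₂`, then `T` has a total dominating set of size 4
containing `u_i` or `u_{i+1}`. -/
theorem TDS_of_deleteEdge_exceptional (T : PlaneGraph) (h : ℕ) (u : ZMod h → ℝ × ℝ)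
    (i : ZMod h) (hT : T.IsNearTriangulation) (hu : T.IsBoundaryCycle u)
    (hexc : (T.deleteEdge (u i) (u (i + 1))).IsExceptional) :
    ∃ D : Finset (ℝ × ℝ), T.IsTDS D ∧ D.card = 4 ∧ (u i ∈ D ∨ u (i + 1) ∈ D) := by
  obtain ⟨-, -, -, hadj, hout, -⟩ := hu
  rcases hexc with hiso | hiso
  · exact hT.exists_isTDS_of_deleteEdge (by decide +kernel)
      (fun a b hab hadj => (PlaneGraph.exc1Edges_dominator_or_obstruction a b hab hadj).imp_left
        fun ⟨D, _, hD⟩ => ⟨D, hD⟩) (hadj i) (hout i) hiso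
  · exact hT.exists_isTDS_of_deleteEdge (by decide +kernel)
      (fun a b hab hadj => (PlaneGraph.exc2Edges_dominator_or_obstruction a b hab hadj).imp_left
        fun ⟨D, _, hD⟩ => ⟨D, hD⟩) (hadj i) (hout i) hiso
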